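/- Let N₀ ∈ ℕ, s ≥ 0, and let χ ∈ C^∞(ℝ^{n+1}_{t,x}) satisfy −N₀−2 ≤ χ ≤ s, χ = s on {|(t,x)| ≤ 1} and χ = −N₀−2 on {|(t,x)| ≥ 3/2}. For 0 < δ ≤ 1 define M_δ(t,x,ζ) = ⟨ζ⟩^{χ(t,x)} (1 + δ⟨ζ⟩)^{−(N₀+s+2)} for ζ ∈ ℝ^{2n+1}, with ⟨ζ⟩ = (1+|ζ|²)^{1/2}. Then for all multi-indices α ∈ ℕ^{n+1} and β ∈ ℕ^{2n+1} there exists a constant C_{α,β} > 0 such that for all 0 < δ ≤ 1, (t,x) ∈ ℝ^{n+1} and ζ ∈ ℝ^{2n+1}, |∂^α_{t,x} ∂^β_ζ M_δ(t,x,ζ)| ≤ C_{α,β} (1 + log⟨ζ⟩)^{|α|} ⟨ζ⟩^{−|β|} M_δ(t,x,ζ). -/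

import Mathlib

open MeasureTheory
open scoped ENNReal Real

noncomputable section

/-- `ℝ^m` with the Euclidean norm. -/
abbrev E (m : ℕ) : Type := EuclideanSpace ℝ (Fin m)

/-- the japanese bracket `⟨ζ⟩ = (1+|ζ|²)^{1/2}` -/
def jb {m : ℕ} (ζ : E m) : ℝ := Real.sqrt (1 + ‖ζ‖ ^ 2)

/-- the weight `M_δ(t,x,ζ) = ⟨ζ⟩^{χ(t,x)} (1+δ⟨ζ⟩)^{-(N₀+s+2)}` -/
def Mdel {n : ℕ} (N₀ : ℕ) (s : ℝ) (χ : E (n + 1) → ℝ) (δ : ℝ)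
    (p : E (n + 1)) (ζ : E (2 * n + 1)) : ℝ :=
  jb ζ ^ χ p * (1 + δ * jb ζ) ^ (-((N₀ : ℝ) + s + 2))

lemma aux_pc (q : Polynomial ℝ) (m : WithTop ℕ∞) : ContDiff ℝ m (fun a : ℝ => q.eval a) := by
  have h := q.contDiff_aeval (𝕜 := ℝ) m
  simp only [Polynomial.coe_aeval_eq_eval] at h
  exact h

open Polynomial in
lemma aux_poly_exp (A B : ℝ) (i : ℕ) : ∀ q : Polynomial ℝ, ∃ C : ℝ, 0 ≤ C ∧ ∀ L : ℝ, 0 ≤ L →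
    ∀ a ∈ Set.Icc A B,
      |iteratedDeriv i (fun a => q.eval a * Real.exp (a * L)) a|
        ≤ C * (1 + L) ^ i * Real.exp (a * L) := by
  induction i with
  | zero =>
    intro q
    obtain ⟨C, hC⟩ := (isCompact_Icc (a := A) (b := B)).exists_bound_of_continuousOn
      (f := fun a => q.eval a) q.continuous.continuousOn
    refine ⟨max C 0, le_max_right _ _, fun L hL a ha => ?_⟩
    have := hC a ha
    simp only [iteratedDeriv_zero, pow_zero, mul_one, abs_mul, Real.abs_exp]
    gcongr
    exact this.trans (le_max_left _ _)
  | succ i ih =>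
    intro q
    obtain ⟨C1, h1, H1⟩ := ih (derivative q)
    obtain ⟨C2, h2, H2⟩ := ih q
    refine ⟨C1 + C2, by positivity, fun L hL a ha => ?_⟩
    have hd : deriv (fun a => q.eval a * Real.exp (a * L)) =
        (fun a => (derivative q).eval a * Real.exp (a * L)) +
          (fun a => L * (q.eval a * Real.exp (a * L))) := by
      funext a
      have h := (q.hasDerivAt a).mul (((hasDerivAt_id a).mul_const L).exp)
      have h' := h.deriv
      simp only [Pi.add_apply]
      rw [show (fun a => q.eval a * Real.exp (a * L)) = (fun x => eval x q) * fun x => Real.exp (id x * L) from rfl, h']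
      simp only [id]; ring
    have s1 : ∀ r : Polynomial ℝ, ContDiff ℝ i (fun a => r.eval a * Real.exp (a * L)) := by
      intro r
      exact (aux_pc r i : ContDiff ℝ i (fun a => r.eval a)).mul (by fun_prop)
    rw [iteratedDeriv_succ', hd, iteratedDeriv_add (s1 _).contDiffAt
      (contDiff_const.mul (s1 q)).contDiffAt, iteratedDeriv_const_mul_field]
    refine (abs_add_le _ _).trans ?_
    rw [abs_mul, abs_of_nonneg hL]
    have e1 := H1 L hL a ha
    have e2 := H2 L hL a ha
    have e3 := mul_le_mul_of_nonneg_left e2 hL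
    have e4 : 0 ≤ (1 + L) ^ i * Real.exp (a * L) := by positivity
    rw [pow_succ]
    nlinarith [mul_nonneg h1 (mul_nonneg hL e4), mul_nonneg h2 e4]

lemma aux_chi (n N₀ : ℕ) (χ : E (n + 1) → ℝ) (hχ : ContDiff ℝ (⊤ : ℕ∞) χ)
    (hχ2 : ∀ p : E (n + 1), (3 : ℝ) / 2 ≤ ‖p‖ → χ p = -((N₀ : ℝ) + 2)) (k : ℕ) :
    ∃ D : ℝ, 1 ≤ D ∧ ∀ p, ∀ i, 1 ≤ i → i ≤ k → ‖iteratedFDeriv ℝ i χ p‖ ≤ D ^ i := by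
  have key : ∀ i, 1 ≤ i → ∃ C : ℝ, ∀ p, ‖iteratedFDeriv ℝ i χ p‖ ≤ C := by
    intro i hi
    let f : E (n+1) → ℝ := fun p => χ p + ((N₀ : ℝ) + 2)
    have hf : ContDiff ℝ (⊤ : ℕ∞) f := hχ.add contDiff_const
    have hs : HasCompactSupport f := by
      refine HasCompactSupport.intro (isCompact_closedBall (0 : E (n+1)) (3/2)) fun p hp => ?_
      have : (3 : ℝ) / 2 ≤ ‖p‖ := by
        simp at hp; exact hp.le
      simp [f, hχ2 p this]
    obtain ⟨C, hC⟩ := (hf.continuous_iteratedFDeriv (m := i) (by exact_mod_cast le_top)).bounded_above_of_compact_support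
      (hs.iteratedFDeriv i)
    refine ⟨C, fun p => ?_⟩
    have : iteratedFDeriv ℝ i f p = iteratedFDeriv ℝ i χ p := by
      have := iteratedFDeriv_add_apply (𝕜 := ℝ) (i := i) (x := p) (f := χ) (g := fun _ => ((N₀ : ℝ) + 2))
        (hχ.of_le (by exact_mod_cast le_top)).contDiffAt contDiff_const.contDiffAt
      rw [iteratedFDeriv_const_of_ne (by omega), Pi.zero_apply] at this
      rw [add_zero] at this
      exact this
    rw [← this]; exact hC p
  choose! C hC using key
  refine ⟨1 + ∑ i ∈ Finset.range (k+1), |C i|, ?_, fun p i hi hik => ?_⟩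
  · have : 0 ≤ ∑ i ∈ Finset.range (k+1), |C i| := Finset.sum_nonneg fun _ _ => abs_nonneg _
    linarith
  · have h0 : 0 ≤ ∑ i ∈ Finset.range (k+1), |C i| := Finset.sum_nonneg fun _ _ => abs_nonneg _
    have h1 : |C i| ≤ ∑ i ∈ Finset.range (k+1), |C i| :=
      Finset.single_le_sum (f := fun i => |C i|) (fun _ _ => abs_nonneg _) (by simp; omega)
    calc _ ≤ C i := hC i hi p
      _ ≤ 1 + ∑ i ∈ Finset.range (k+1), |C i| := by linarith [le_abs_self (C i)]
      _ ≤ _ := le_self_pow₀ (by linarith) (by omega)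

lemma aux_comp (n N₀ : ℕ) (s : ℝ) (χ : E (n + 1) → ℝ) (hχ : ContDiff ℝ (⊤ : ℕ∞) χ)
    (hχlb : ∀ p, -((N₀ : ℝ) + 2) ≤ χ p) (hχub : ∀ p, χ p ≤ s)
    (hχ2 : ∀ p : E (n + 1), (3 : ℝ) / 2 ≤ ‖p‖ → χ p = -((N₀ : ℝ) + 2)) (k : ℕ)
    (q : Polynomial ℝ) :
    ∃ C : ℝ, 0 ≤ C ∧ ∀ L : ℝ, 0 ≤ L → ∀ p,
      ‖iteratedFDeriv ℝ k (fun p => q.eval (χ p) * Real.exp (χ p * L)) p‖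
        ≤ C * (1 + L) ^ k * Real.exp (χ p * L) := by
  obtain ⟨D, hD1, hD⟩ := aux_chi n N₀ χ hχ hχ2 k
  choose c hc0 hc using fun i => aux_poly_exp (-((N₀ : ℝ) + 2)) s i q
  have h0 : 0 ≤ ∑ i ∈ Finset.range (k+1), c i := Finset.sum_nonneg fun _ _ => hc0 _
  refine ⟨k.factorial * (∑ i ∈ Finset.range (k+1), c i) * D ^ k, by positivity, fun L hL p => ?_⟩
  have hg : ContDiff ℝ (⊤ : ℕ∞) (fun a => q.eval a * Real.exp (a * L)) :=
    (aux_pc q (⊤ : ℕ∞) : ContDiff ℝ (⊤ : ℕ∞) (fun a => q.eval a)).mul (by fun_prop)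
  have := norm_iteratedFDeriv_comp_le hg hχ (n := k) (by exact_mod_cast le_top) p
    (C := (∑ i ∈ Finset.range (k+1), c i) * (1 + L) ^ k * Real.exp (χ p * L)) (D := D)
    (fun i hi => by
      rw [norm_iteratedFDeriv_eq_norm_iteratedDeriv, Real.norm_eq_abs]
      refine (hc i L hL (χ p) ⟨hχlb p, hχub p⟩).trans ?_
      gcongr
      · exact Finset.single_le_sum (f := c) (fun _ _ => hc0 _) (by simp; omega)
      · linarith) (hD p)
  refine this.trans (le_of_eq (by ring))

open Polynomial in
lemma aux_G (κ : ℝ) (m : ℕ) : ∃ P : Polynomial (Polynomial ℝ), ∀ δ : ℝ, 0 < δ → ∀ a u : ℝ, 0 < u →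
    iteratedDeriv m (fun u => Real.sqrt u ^ a * (1 + δ * Real.sqrt u) ^ (-κ)) u =
      (u⁻¹) ^ m * P.evalEval a (δ * Real.sqrt u / (1 + δ * Real.sqrt u)) *
        (Real.sqrt u ^ a * (1 + δ * Real.sqrt u) ^ (-κ)) := by
  induction m with
  | zero => exact ⟨1, fun δ hδ a u hu => by simp⟩
  | succ m ih =>
    obtain ⟨P, hP⟩ := ih
    refine ⟨(C (C (1/2) * X) - C (C (κ/2)) * X - C (C (m : ℝ))) * P
      + derivative P * X * (1 - X) * C (C (1/2)), fun δ hδ a u hu => ?_⟩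
    rw [iteratedDeriv_succ]
    have hev : iteratedDeriv m (fun u => Real.sqrt u ^ a * (1 + δ * Real.sqrt u) ^ (-κ)) =ᶠ[nhds u]
        fun u => (u⁻¹) ^ m * P.evalEval a (δ * Real.sqrt u / (1 + δ * Real.sqrt u)) *
        (Real.sqrt u ^ a * (1 + δ * Real.sqrt u) ^ (-κ)) := by
      filter_upwards [lt_mem_nhds hu] with v hv using hP δ hδ a v hv
    rw [hev.deriv_eq]
    obtain ⟨r, hr, rfl⟩ : ∃ r : ℝ, 0 < r ∧ u = r ^ 2 :=
      ⟨Real.sqrt u, Real.sqrt_pos.2 hu, (Real.sq_sqrt hu.le).symm⟩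
    have hsq : Real.sqrt (r ^ 2) = r := Real.sqrt_sq hr.le
    have hw : 0 < 1 + δ * r := by positivity
    have d1 : HasDerivAt Real.sqrt (1 / (2 * r)) (r ^ 2) := by
      have := Real.hasDerivAt_sqrt hu.ne'
      rwa [hsq] at this
    have d2 := d1.rpow_const (p := a) (Or.inl (by rw [hsq]; exact hr.ne'))
    have d3 := (d1.const_mul δ).const_add 1
    have d4 := d3.rpow_const (p := -κ) (Or.inl (by rw [hsq]; exact hw.ne'))
    have d5 := (d1.const_mul δ).div d3 (by rw [hsq]; exact hw.ne')
    have d6 := ((P.map (evalRingHom a)).hasDerivAt _).comp (r ^ 2) d5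
    have d7 := (hasDerivAt_inv hu.ne').pow m
    have d8 := (d7.mul d6).mul (d2.mul d4)
    have d9 := d8.deriv
    simp only [← map_evalRingHom_eval]
    refine d9.trans ?_
    simp only [Pi.mul_apply, Pi.pow_apply, Pi.div_apply, Function.comp, hsq, derivative_map,
      map_evalRingHom_eval, evalEval_add, evalEval_mul, evalEval_sub, evalEval_C, evalEval_X, evalEval_one,
      eval_mul, eval_C, eval_X]
    rw [Real.rpow_sub_one hr.ne', Real.rpow_sub_one hw.ne']
    generalize evalEval a (δ * r / (1 + δ * r)) P = p
    generalize evalEval a (δ * r / (1 + δ * r)) (derivative P) = p'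
    generalize r ^ a = R
    generalize (1 + δ * r) ^ (-κ) = W
    have hr' := hr.ne'
    have hw' := hw.ne'
    rcases m with _ | m
    · simp
      field_simp
      ring
    · simp only [Nat.add_sub_cancel]
      push_cast
      simp only [pow_succ ((r ^ 2)⁻¹)]
      generalize ((r ^ 2)⁻¹) ^ m = Z
      field_simp
      ring

lemma aux_f {m : ℕ} (ζ : E m) (i : ℕ) (hi : 1 ≤ i) :
    ‖iteratedFDeriv ℝ i (fun ζ : E m => 1 + ‖ζ‖ ^ 2) ζ‖ ≤ 2 * jb ζ ^ 2 * ((jb ζ)⁻¹) ^ i := by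
  have hJ2 : jb ζ ^ 2 = 1 + ‖ζ‖ ^ 2 := Real.sq_sqrt (by positivity)
  have hJ : 0 < jb ζ := Real.sqrt_pos.2 (by positivity)
  have hle : ‖ζ‖ ≤ jb ζ := Real.le_sqrt_of_sq_le (by linarith)
  have hf : fderiv ℝ (fun ζ : E m => 1 + ‖ζ‖ ^ 2) = ⇑((2 : ℝ) • innerSL ℝ (E := E m)) := by
    funext x
    have := ((hasStrictFDerivAt_norm_sq x).hasFDerivAt.const_add 1).fderiv
    rw [this]
    ext v
    simp
  obtain ⟨i, rfl⟩ : ∃ j, i = j + 1 := ⟨i - 1, by omega⟩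
  rw [← norm_iteratedFDeriv_fderiv, hf]
  have hn2 : ‖(2 : ℝ) • innerSL ℝ (E := E m)‖ ≤ 2 := by
    refine ContinuousLinearMap.opNorm_le_bound _ (by norm_num) fun x => ?_
    rw [smul_apply, norm_smul, innerSL_apply_norm]; simp
  rcases i with _ | _ | i
  · rw [norm_iteratedFDeriv_zero, smul_apply, norm_smul, innerSL_apply_norm]
    simp
    rw [pow_two, mul_assoc, mul_assoc, mul_inv_cancel₀ hJ.ne']; linarith
  · rw [norm_iteratedFDeriv_one, ContinuousLinearMap.fderiv]
    refine hn2.trans (le_of_eq ?_)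
    rw [zero_add, one_add_one_eq_two, inv_pow, mul_assoc, mul_inv_cancel₀ (pow_pos hJ 2).ne', mul_one]
  · rw [← norm_iteratedFDeriv_fderiv]
    have : fderiv ℝ ⇑((2 : ℝ) • innerSL ℝ (E := E m)) = fun _ => (2 : ℝ) • innerSL ℝ (E := E m) := by
      funext x; exact ContinuousLinearMap.fderiv _
    rw [this, iteratedFDeriv_const_of_ne (by omega)]
    simp; positivity

lemma aux_faa {d : ℕ} (l : ℕ) (g : ℝ → ℝ) (f : E d → ℝ) (ζ : E d)
    (hg : ContDiffAt ℝ l g (f ζ)) (hf : ContDiffAt ℝ l f ζ) :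
    iteratedFDeriv ℝ l (g ∘ f) ζ = ∑ c : OrderedFinpartition l,
      iteratedDeriv c.length g (f ζ) •
        c.compAlongOrderedFinpartition (ContinuousMultilinearMap.mkPiAlgebraFin ℝ c.length ℝ)
          (fun i => iteratedFDeriv ℝ (c.partSize i) f ζ) := by
  rw [iteratedFDeriv_comp hg hf le_rfl, FormalMultilinearSeries.taylorComp]
  refine Finset.sum_congr rfl fun c _ => ?_
  ext v
  rw [FormalMultilinearSeries.compAlongOrderedFinpartition_apply,
    smul_apply, OrderedFinpartition.compAlongOrderFinpartition_apply,
    ContinuousMultilinearMap.mkPiAlgebraFin_apply, List.prod_ofFn]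
  simp only [ftaylorSeries]
  rw [iteratedFDeriv_apply_eq_iteratedDeriv_mul_prod, smul_eq_mul, smul_eq_mul, mul_comm]

lemma aux_T {d : ℕ} (l : ℕ) (c : OrderedFinpartition l) (ζ : E d) :
    ‖c.compAlongOrderedFinpartition (ContinuousMultilinearMap.mkPiAlgebraFin ℝ c.length ℝ)
          (fun i => iteratedFDeriv ℝ (c.partSize i) (fun ζ : E d => 1 + ‖ζ‖ ^ 2) ζ)‖
      ≤ (2 * jb ζ ^ 2) ^ c.length * ((jb ζ)⁻¹) ^ l := by
  refine (c.norm_compAlongOrderedFinpartition_le _ _).trans ?_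
  rw [ContinuousMultilinearMap.norm_mkPiAlgebraFin, one_mul]
  refine (Finset.prod_le_prod (fun _ _ => norm_nonneg _)
    (fun i _ => aux_f ζ (c.partSize i) (c.partSize_pos i))).trans (le_of_eq ?_)
  rw [Finset.prod_mul_distrib]
  congr 1
  · simp
  · have := c.prod_sigma_eq_prod (fun _ => (jb ζ)⁻¹)
    simpa using this

theorem statement14
    (n : ℕ) (hn : 1 ≤ n) (N₀ : ℕ) (s : ℝ) (hs : 0 ≤ s)
    (χ : E (n + 1) → ℝ) (hχ : ContDiff ℝ (⊤ : ℕ∞) χ)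
    (hχlb : ∀ p, -((N₀ : ℝ) + 2) ≤ χ p) (hχub : ∀ p, χ p ≤ s)
    (hχ1 : ∀ p : E (n + 1), ‖p‖ ≤ 1 → χ p = s)
    (hχ2 : ∀ p : E (n + 1), (3 : ℝ) / 2 ≤ ‖p‖ → χ p = -((N₀ : ℝ) + 2)) :
    ∀ k l : ℕ, ∃ C : ℝ, 0 < C ∧ ∀ δ : ℝ, 0 < δ → δ ≤ 1 →
      ∀ (p : E (n + 1)) (ζ : E (2 * n + 1)),
        ‖iteratedFDeriv ℝ k
            (fun p' => iteratedFDeriv ℝ l (fun ζ' => Mdel N₀ s χ δ p' ζ') ζ) p‖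
          ≤ C * (1 + Real.log (jb ζ)) ^ k * jb ζ ^ (-(l : ℝ)) * Mdel N₀ s χ δ p ζ := by
  intro k l
  choose P hP using aux_G ((N₀ : ℝ) + s + 2)
  choose K hK0 hK using aux_comp n N₀ s χ hχ hχlb hχub hχ2 k
  have hC0 : 0 ≤ ∑ c : OrderedFinpartition l, ∑ j ∈ Finset.range ((P c.length).natDegree + 1),
    K ((P c.length).coeff j) * 2 ^ c.length :=
      Finset.sum_nonneg fun c _ => Finset.sum_nonneg fun j _ => mul_nonneg (hK0 _) (by positivity)
  refine ⟨1 + ∑ c : OrderedFinpartition l, ∑ j ∈ Finset.range ((P c.length).natDegree + 1),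
    K ((P c.length).coeff j) * 2 ^ c.length, by linarith, fun δ hδ hδ1 p ζ => ?_⟩
  have hJ2 : jb ζ ^ 2 = 1 + ‖ζ‖ ^ 2 := Real.sq_sqrt (by positivity)
  have hJ : 0 < jb ζ := Real.sqrt_pos.2 (by positivity)
  have hJ1 : 1 ≤ jb ζ := Real.one_le_sqrt.2 (by nlinarith [sq_nonneg ‖ζ‖])
  have hL : 0 ≤ Real.log (jb ζ) := Real.log_nonneg hJ1
  have hu : 0 < 1 + ‖ζ‖ ^ 2 := by positivity
  have hw : 0 < 1 + δ * jb ζ := by positivity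
  set θ : ℝ := δ * jb ζ / (1 + δ * jb ζ) with hθ
  have hθ0 : 0 ≤ θ := by positivity
  have hθ1 : θ ≤ 1 := by rw [hθ, div_le_one hw]; linarith
  set W : ℝ := (1 + δ * jb ζ) ^ (-((N₀ : ℝ) + s + 2)) with hW
  have hW0 : 0 < W := Real.rpow_pos_of_pos hw _
  let T : ∀ c : OrderedFinpartition l, E (2 * n + 1) [×l]→L[ℝ] ℝ := fun c =>
    c.compAlongOrderedFinpartition (ContinuousMultilinearMap.mkPiAlgebraFin ℝ c.length ℝ)
          (fun i => iteratedFDeriv ℝ (c.partSize i) (fun ζ : E (2 * n + 1) => 1 + ‖ζ‖ ^ 2) ζ)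
  have hexp : ∀ a : ℝ, jb ζ ^ a = Real.exp (a * Real.log (jb ζ)) := fun a => by
    rw [Real.rpow_def_of_pos hJ, mul_comm]
  have hfun : (fun p' => iteratedFDeriv ℝ l (fun ζ' => Mdel N₀ s χ δ p' ζ') ζ) =
      fun p' => ∑ c : OrderedFinpartition l, ∑ j ∈ Finset.range ((P c.length).natDegree + 1),
        (((P c.length).coeff j).eval (χ p') * Real.exp (χ p' * Real.log (jb ζ))) •
          ((((jb ζ ^ 2)⁻¹) ^ c.length * θ ^ j * W) • T c) := by
    funext p'
    have hGs : ContDiffAt ℝ l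
        (fun u => Real.sqrt u ^ χ p' * (1 + δ * Real.sqrt u) ^ (-((N₀ : ℝ) + s + 2)))
        (1 + ‖ζ‖ ^ 2) := by
      have h1 : ContDiffAt ℝ l Real.sqrt (1 + ‖ζ‖ ^ 2) := Real.contDiffAt_sqrt hu.ne'
      exact (h1.rpow_const_of_ne hJ.ne').mul
        ((contDiffAt_const.add (contDiffAt_const.mul h1)).rpow_const_of_ne hw.ne')
    have := aux_faa l (fun u => Real.sqrt u ^ χ p' * (1 + δ * Real.sqrt u) ^ (-((N₀ : ℝ) + s + 2)))
      (fun ζ : E (2 * n + 1) => 1 + ‖ζ‖ ^ 2) ζ hGs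
      (contDiff_const.add (contDiff_norm_sq ℝ)).contDiffAt
    refine this.trans (Finset.sum_congr rfl fun c _ => ?_)
    rw [hP c.length δ hδ (χ p') _ hu]
    change (_ * Polynomial.evalEval (χ p') θ (P c.length) * (jb ζ ^ χ p' * W)) • T c = _
    rw [Polynomial.evalEval, Polynomial.eval_eq_sum_range (p := P c.length), Polynomial.eval_finsetSum,
      Finset.mul_sum, Finset.sum_mul, Finset.sum_smul]
    refine Finset.sum_congr rfl fun j _ => ?_
    rw [smul_smul, hexp, hJ2]
    congr 1
    simp only [Polynomial.eval_mul, Polynomial.eval_pow, Polynomial.eval_C]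
    ring
  have hφ : ∀ q : Polynomial ℝ, ContDiff ℝ k
      (fun p' => q.eval (χ p') * Real.exp (χ p' * Real.log (jb ζ))) := fun q => by
    have hχk : ContDiff ℝ k χ := hχ.of_le (by exact_mod_cast le_top)
    exact ((aux_pc q k).comp hχk).mul (hχk.mul contDiff_const).exp
  have hcd : ∀ (c : OrderedFinpartition l) (j : ℕ), ContDiff ℝ k
      (fun p' => (((P c.length).coeff j).eval (χ p') * Real.exp (χ p' * Real.log (jb ζ))) •
          ((((jb ζ ^ 2)⁻¹) ^ c.length * θ ^ j * W) • T c)) := fun c j =>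
    (hφ _).smul contDiff_const
  have hM : Mdel N₀ s χ δ p ζ = Real.exp (χ p * Real.log (jb ζ)) * W := by
    rw [← hexp]; rfl
  have hterm : ∀ c : OrderedFinpartition l, ∀ j,
      ‖iteratedFDeriv ℝ k (fun p' => (((P c.length).coeff j).eval (χ p') *
          Real.exp (χ p' * Real.log (jb ζ))) •
          ((((jb ζ ^ 2)⁻¹) ^ c.length * θ ^ j * W) • T c)) p‖ ≤
        (K ((P c.length).coeff j) * 2 ^ c.length) *
          ((1 + Real.log (jb ζ)) ^ k * jb ζ ^ (-(l : ℝ)) * Mdel N₀ s χ δ p ζ) := by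
    intro c j
    have hV : ‖((((jb ζ ^ 2)⁻¹) ^ c.length * θ ^ j * W) • T c)‖ ≤
        2 ^ c.length * W * ((jb ζ)⁻¹) ^ l := by
      rw [norm_smul, Real.norm_of_nonneg (by positivity)]
      calc _ ≤ (((jb ζ ^ 2)⁻¹) ^ c.length * 1 * W) *
            ((2 * jb ζ ^ 2) ^ c.length * ((jb ζ)⁻¹) ^ l) := by
            gcongr
            · exact pow_le_one₀ hθ0 hθ1
            · exact aux_T l c ζ
        _ = ((jb ζ ^ 2)⁻¹ * (jb ζ ^ 2)) ^ c.length * (2 ^ c.length * W * ((jb ζ)⁻¹) ^ l) := by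
            rw [mul_pow, mul_pow]; ring
        _ = _ := by rw [inv_mul_cancel₀ (by positivity), one_pow, one_mul]
    rw [iteratedFDeriv_smul_const_apply (hφ _).contDiffAt]
    refine (ContinuousLinearMap.norm_compContinuousMultilinearMap_le _ _).trans ?_
    have hR : ‖(ContinuousLinearMap.id ℝ ℝ).smulRight
        ((((jb ζ ^ 2)⁻¹) ^ c.length * θ ^ j * W) • T c)‖ ≤ 2 ^ c.length * W * ((jb ζ)⁻¹) ^ l := by
      rw [ContinuousLinearMap.norm_smulRight_apply, ContinuousLinearMap.norm_id, one_mul]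
      exact hV
    calc _ ≤ (2 ^ c.length * W * ((jb ζ)⁻¹) ^ l) * (K ((P c.length).coeff j) *
          (1 + Real.log (jb ζ)) ^ k * Real.exp (χ p * Real.log (jb ζ))) := by
          gcongr
          exact hK _ _ hL p
      _ = _ := by
          rw [hM, Real.rpow_neg hJ.le, Real.rpow_natCast, inv_pow]; ring
  have hM0 : 0 ≤ Mdel N₀ s χ δ p ζ := by rw [hM]; positivity
  have hX : 0 ≤ (1 + Real.log (jb ζ)) ^ k * jb ζ ^ (-(l : ℝ)) * Mdel N₀ s χ δ p ζ := by positivity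
  rw [hfun, iteratedFDeriv_fun_sum_apply
    (fun c _ => (ContDiff.sum fun j _ => hcd c j).contDiffAt)]
  calc _ ≤ ∑ c : OrderedFinpartition l, ∑ j ∈ Finset.range ((P c.length).natDegree + 1),
      (K ((P c.length).coeff j) * 2 ^ c.length) *
          ((1 + Real.log (jb ζ)) ^ k * jb ζ ^ (-(l : ℝ)) * Mdel N₀ s χ δ p ζ) := by
        refine norm_sum_le_of_le _ fun c _ => ?_
        rw [iteratedFDeriv_fun_sum_apply
          (fun j _ => (hcd c j).contDiffAt)]
        exact norm_sum_le_of_le _ fun j _ => hterm c j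
    _ ≤ _ := by
        simp only [← Finset.sum_mul]
        nlinarith
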